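/- Let (G_k)_{k≥1} be a sequence of finite simple connected vertex-transitive (q+1)-regular graphs with ν_k = |V(G_k)| → ∞, and suppose the empirical spectral measures μ_k = (1/ν_k)·∑_{λ ∈ Spec(P(G_k))} δ_λ (eigenvalues counted with multiplicity) converge weakly to a probability measure μ_P on [−1,1]. Let U⁺(G_k) denote the positive support of the Grover matrix of G_k, i.e. the matrix indexed by arcs with entry 1 where the Grover matrix of G_k is positive and 0 elsewhere. Then for every real u with |u| < 1 and (1 + qu²) − (q+1)ut > 0 for all t ∈ [−1,1], lim_{k→∞} det(I − u·U⁺(G_k))^{1/ν_k} = (1 − u²)^{(q−1)/2} · exp[ ∫ log( (1 + qu²) − (q+1)uλ ) dμ_P(λ) ]. (Grover(Positive Support)/Ihara Zeta Correspondence; this is the theorem of Chinta, Jorgenson and Karlsson for the generalized Ihara zeta function.) -/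

import Mathlib

open Matrix BigOperators Filter MeasureTheory

/-- The Grover matrix of a graph `G` (real entries). -/
noncomputable def groverMatrix {V : Type*} [Fintype V] [DecidableEq V] (G : SimpleGraph V)
    [DecidableRel G.Adj] : Matrix G.Dart G.Dart ℝ :=
  fun e f =>
    if f = e.symm then 2 / (G.degree f.snd : ℝ) - 1
    else if f.snd = e.fst then 2 / (G.degree f.snd : ℝ)
    else 0

/-- The positive support of a real square matrix: entry `1` where the matrix is
positive and `0` elsewhere. -/
noncomputable def posSupport {n : Type*} (M : Matrix n n ℝ) : Matrix n n ℝ :=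
  fun i j => if 0 < M i j then 1 else 0

/-- The transition probability matrix of the simple random walk on `G`. -/
noncomputable def transMatrix {V : Type*} [Fintype V] [DecidableEq V] (G : SimpleGraph V)
    [DecidableRel G.Adj] : Matrix V V ℝ :=
  fun u v => if G.Adj u v then 1 / (G.degree u : ℝ) else 0

theorem Matrix.det_smul_one_sub_smul_of_isHermitian {n : Type*} [Fintype n] [DecidableEq n]
    {P : Matrix n n ℝ} (hP : P.IsHermitian) (a b : ℝ) :
    det (a • (1 : Matrix n n ℝ) - b • P) = (P.charpoly.roots.map fun lam => a - b * lam).prod := by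
  have hprod : (P.charpoly.roots.map fun lam => a - b * lam).prod
      = ∏ i, (a - b * hP.eigenvalues i) := by
    rw [hP.roots_charpoly_eq_eigenvalues, Multiset.map_map]
    rfl
  rw [hprod]
  rcases eq_or_ne b 0 with rfl | hb
  · simp
  · have h := eval_charpoly P (a / b)
    rw [hP.charpoly_eq, Polynomial.eval_prod] at h
    have hmat : a • (1 : Matrix n n ℝ) - b • P = b • (scalar n (a / b) - P) := by
      rw [smul_sub, scalar_apply, ← smul_one_eq_diagonal, smul_smul, mul_div_cancel₀ a hb]
    rw [hmat, det_smul, ← h, Fintype.card, ← Finset.prod_const, ← Finset.prod_mul_distrib]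
    refine Finset.prod_congr rfl fun i _ => ?_
    simp
    field_simp

namespace SimpleGraph

variable {V : Type*} [Fintype V] [DecidableEq V] (G : SimpleGraph V) [DecidableRel G.Adj]

/-- The arc-by-vertex incidence matrix recording the origin of each arc. -/
def originMatrix : Matrix G.Dart V ℝ := fun e v => if e.fst = v then 1 else 0

/-- The vertex-by-arc incidence matrix recording the terminus of each arc. -/
def terminusMatrix : Matrix V G.Dart ℝ := fun v f => if f.snd = v then 1 else 0

/-- The permutation matrix of arc reversal. -/
def reversalMatrix : Matrix G.Dart G.Dart ℝ := fun e f => if f = e.symm then 1 else 0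

theorem reversalMatrix_mul_apply {α : Type*} (M : Matrix G.Dart α ℝ) (e : G.Dart) (v : α) :
    (G.reversalMatrix * M) e v = M e.symm v := by
  simp [mul_apply, reversalMatrix]

theorem reversalMatrix_mul_self : G.reversalMatrix * G.reversalMatrix = 1 := by
  ext e f
  rw [reversalMatrix_mul_apply]
  simp [reversalMatrix, one_apply, eq_comm]

theorem terminusMatrix_mul_originMatrix :
    G.terminusMatrix * G.originMatrix = G.adjMatrix ℝ := by
  ext v w
  simp only [mul_apply, terminusMatrix, originMatrix, adjMatrix_apply, mul_ite, mul_one, mul_zero,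
    ← ite_and]
  split_ifs with h
  · rw [Finset.sum_eq_single ⟨(w, v), h.symm⟩]
    · simp
    · rintro ⟨⟨x, y⟩, hxy⟩ _ hne
      refine if_neg ?_
      rintro ⟨rfl, rfl⟩
      exact hne rfl
    · simp
  · refine Finset.sum_eq_zero fun f _ => if_neg ?_
    rintro ⟨rfl, rfl⟩
    exact h f.adj.symm

theorem terminusMatrix_mul_reversalMatrix_mul_originMatrix {d : ℕ}
    (hreg : G.IsRegularOfDegree d) :
    G.terminusMatrix * (G.reversalMatrix * G.originMatrix) = (d : ℝ) • 1 := by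
  ext v w
  rw [mul_apply]
  simp only [reversalMatrix_mul_apply, terminusMatrix, originMatrix, Dart.symm_toProd, Prod.fst_swap]
  rw [← Equiv.sum_comp (Dart.symm_involutive (G := G)).toPerm]
  simp only [Function.Involutive.coe_toPerm, Dart.symm_toProd, Prod.snd_swap, Matrix.smul_apply,
    Matrix.one_apply]
  by_cases hvw : v = w
  · subst hvw
    simp [← hreg v, ← G.dart_fst_fiber_card_eq_degree v, Finset.sum_ite, Finset.filter_filter]
  · rw [if_neg hvw, smul_zero]
    refine Finset.sum_eq_zero fun f _ => ?_
    by_cases h : f.fst = v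
    · simp [h, hvw]
    · simp [h]

theorem posSupport_groverMatrix {q : ℕ} (hq : 2 ≤ q) (hreg : G.IsRegularOfDegree (q + 1)) :
    posSupport (groverMatrix G) = G.originMatrix * G.terminusMatrix - G.reversalMatrix := by
  have hq' : (2 : ℝ) ≤ q := by exact_mod_cast hq
  ext e f
  simp only [posSupport, groverMatrix, hreg.degree_eq, Matrix.sub_apply, mul_apply, originMatrix,
    terminusMatrix, reversalMatrix, ite_mul, one_mul, zero_mul, Finset.sum_ite_eq,
    Finset.mem_univ, if_true]
  by_cases h : f = e.symm
  · have hle : 2 / ((q : ℝ) + 1) ≤ 1 := (div_le_one (by positivity)).mpr (by linarith)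
    simp [h, hle]
  · have hpos : (0 : ℝ) < 2 / ((q + 1 : ℕ) : ℝ) := by positivity
    by_cases h' : f.snd = e.fst <;> simp only [h, h', if_true, if_false, hpos, lt_irrefl, sub_zero]

theorem det_smul_one_add_smul_reversalMatrix_eq (a b : ℝ) :
    det (a • 1 + b • G.reversalMatrix) = det (a • 1 - b • G.reversalMatrix) := by
  classical
  let : LinearOrder V := linearOrderOfSTO WellOrderingRel
  let s : G.Dart → ℝ := fun e => if e.fst < e.snd then 1 else -1
  have hs : diagonal s * diagonal s = 1 := by
    rw [diagonal_mul_diagonal, ← diagonal_one]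
    congr 1
    ext e
    by_cases h : e.fst < e.snd <;> simp [s, h]
  have hconj : diagonal s * (a • 1 + b • G.reversalMatrix) * diagonal s
      = a • 1 - b • G.reversalMatrix := by
    ext e f
    simp only [mul_diagonal, diagonal_mul, Matrix.add_apply, Matrix.sub_apply,
      Matrix.smul_apply, reversalMatrix, Matrix.one_apply, smul_eq_mul]
    have hne : e.fst ≠ e.snd := e.adj.ne
    by_cases h1 : e = f
    · subst h1
      have h2 : e ≠ e.symm := e.symm_ne.symm
      by_cases h : e.fst < e.snd <;> simp [s, h, h2]
    · by_cases h2 : f = e.symm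
      · subst h2
        rcases lt_or_gt_of_ne hne with h | h <;> simp [s, h, h.not_gt, h1]
      · simp [h1, h2]
  rw [← hconj, det_mul, det_mul, mul_right_comm, ← det_mul, hs, det_one, one_mul]

theorem det_one_add_smul_reversalMatrix {u : ℝ} (hu : |u| < 1) :
    det (1 + u • G.reversalMatrix) = √(1 - u ^ 2) ^ Fintype.card G.Dart := by
  obtain ⟨h1, h2⟩ := abs_lt.mp hu
  set x := √(1 + u) with hx
  set y := √(1 - u) with hy
  have hx2 : x * x = 1 + u := Real.mul_self_sqrt (by linarith)
  have hy2 : y * y = 1 - u := Real.mul_self_sqrt (by linarith)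
  have hxy : √(1 - u ^ 2) = x * y := by
    rw [hx, hy, ← Real.sqrt_mul (by linarith)]
    ring_nf
  have hJ := G.reversalMatrix_mul_self
  set J := G.reversalMatrix
  set α := (x + y) / 2
  set β := (x - y) / 2
  have hsq : 1 + u • J = (α • 1 + β • J) * (α • 1 + β • J) := by
    simp only [add_mul, mul_add, smul_mul_assoc, mul_smul_comm, one_mul, mul_one, hJ]
    have e1 : α * α + β * β = 1 := by simp only [α, β]; linear_combination (hx2 + hy2) / 2
    have e2 : u = α * β + β * α := by simp only [α, β]; linear_combination (hy2 - hx2) / 2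
    calc 1 + u • J = (α * α + β * β) • 1 + (α * β + β * α) • J := by rw [e1, ← e2, one_smul]
      _ = _ := by module
  have hmul : (α • 1 + β • J) * (α • 1 - β • J) = (x * y) • 1 := by
    simp only [add_mul, mul_sub, smul_mul_assoc, mul_smul_comm, one_mul, mul_one, hJ]
    have e1 : x * y = α * α - β * β := by simp only [α, β]; ring
    rw [e1]
    module
  rw [hsq, det_mul]
  nth_rw 2 [det_smul_one_add_smul_reversalMatrix_eq]
  rw [← det_mul, hmul, det_smul, det_one, mul_one, hxy]

theorem transMatrix_eq {d : ℕ} (hreg : G.IsRegularOfDegree d) :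
    transMatrix G = (1 / (d : ℝ)) • G.adjMatrix ℝ := by
  ext v w
  simp [transMatrix, hreg.degree_eq, adjMatrix_apply]

theorem isHermitian_transMatrix {d : ℕ} (hreg : G.IsRegularOfDegree d) :
    (transMatrix G).IsHermitian := by
  rw [G.transMatrix_eq hreg, IsHermitian, conjTranspose_eq_transpose_of_trivial, transpose_smul,
    transpose_adjMatrix]

theorem mem_Icc_of_mem_roots_charpoly_transMatrix {lam : ℝ}
    (h : lam ∈ (transMatrix G).charpoly.roots) : lam ∈ Set.Icc (-1 : ℝ) 1 := by
  have hev : Module.End.HasEigenvalue (toLin' (transMatrix G)) lam := by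
    rw [Module.End.hasEigenvalue_iff_isRoot_charpoly, charpoly_toLin']
    exact Polynomial.isRoot_of_mem_roots h
  obtain ⟨k, hk⟩ := eigenvalue_mem_ball hev
  have hdiag : transMatrix G k k = 0 := by simp [transMatrix]
  have hsum : ∑ j ∈ Finset.univ.erase k, ‖transMatrix G k j‖ ≤ 1 := by
    calc ∑ j ∈ Finset.univ.erase k, ‖transMatrix G k j‖
        ≤ ∑ j, ‖transMatrix G k j‖ :=
          Finset.sum_le_sum_of_subset_of_nonneg (Finset.subset_univ _) fun _ _ _ => norm_nonneg _
      _ = G.degree k * (1 / (G.degree k : ℝ)) := by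
          simp only [transMatrix, apply_ite norm, norm_zero, ← Finset.sum_filter,
            ← G.neighborFinset_eq_filter, Finset.sum_const, card_neighborFinset_eq_degree]
          simp
      _ ≤ 1 := by
          rw [mul_one_div]
          exact div_self_le_one _
  rw [hdiag, Metric.mem_closedBall, dist_zero_right, Real.norm_eq_abs] at hk
  exact abs_le.mp (hk.trans hsum)

/-- The Ihara–Bass determinant formula for a regular graph. -/
theorem det_one_sub_smul_posSupport_groverMatrix {q : ℕ} (hq : 2 ≤ q)
    (hreg : G.IsRegularOfDegree (q + 1)) {u : ℝ} (hu : |u| < 1) :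
    det (1 - u • posSupport (groverMatrix G)) =
      (√(1 - u ^ 2) ^ (q + 1) * (1 - u ^ 2)⁻¹) ^ Fintype.card V *
        ((transMatrix G).charpoly.roots.map
          fun lam => (1 + (q : ℝ) * u ^ 2) - ((q : ℝ) + 1) * u * lam).prod := by
  have hw : 1 - u ^ 2 ≠ 0 := (sub_pos.mpr ((sq_lt_one_iff_abs_lt_one u).mpr hu)).ne'
  set w := 1 - u ^ 2 with hwdef
  have hJ := G.reversalMatrix_mul_self
  have hLK := G.terminusMatrix_mul_originMatrix
  have hLJK := G.terminusMatrix_mul_reversalMatrix_mul_originMatrix hreg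
  have hdet := G.det_one_add_smul_reversalMatrix hu
  rw [G.posSupport_groverMatrix hq hreg]
  set J := G.reversalMatrix
  set K := G.originMatrix
  set L := G.terminusMatrix
  have hinv : (1 + u • J) * (1 - u • J) = w • 1 := by
    simp only [add_mul, mul_sub, smul_mul_assoc, mul_smul_comm, one_mul, mul_one, hJ, hwdef]
    module
  have hfact : 1 - u • (K * L - J) = (1 + u • J) * (1 - ((u * w⁻¹) • ((1 - u • J) * K)) * L) := by
    rw [mul_sub, mul_one, Matrix.smul_mul, Matrix.mul_smul, ← Matrix.mul_assoc, ← Matrix.mul_assoc,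
      hinv, Matrix.smul_mul, Matrix.smul_mul, Matrix.one_mul, smul_smul, mul_assoc,
      inv_mul_cancel₀ hw]
    module
  have hsmall : 1 - L * ((u * w⁻¹) • ((1 - u • J) * K)) =
      w⁻¹ • ((1 + (q : ℝ) * u ^ 2) • 1 - (((q : ℝ) + 1) * u) • transMatrix G) := by
    have hq1 : ((q + 1 : ℕ) : ℝ) ≠ 0 := by positivity
    rw [Matrix.mul_smul, Matrix.sub_mul, Matrix.one_mul, Matrix.smul_mul, Matrix.mul_sub,
      Matrix.mul_smul, hLK, hLJK,
      G.transMatrix_eq hreg]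
    have e1 : w⁻¹ * (1 + (q : ℝ) * u ^ 2) = 1 + u * w⁻¹ * u * (q + 1 : ℕ) := by
      field_simp
      push_cast
      rw [hwdef]
      ring
    have e2 : ((q : ℝ) + 1) * u * (1 / (q + 1 : ℕ)) = u := by
      push_cast at hq1 ⊢
      field_simp
    simp only [smul_sub, smul_smul, e1, e2]
    module
  have hcardD : Fintype.card G.Dart = (q + 1) * Fintype.card V := by
    rw [dart_card_eq_sum_degrees, Finset.sum_congr rfl fun v _ => hreg v]
    simp [mul_comm]
  rw [hfact, det_mul, hdet, det_one_sub_mul_comm, hsmall, det_smul,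
    det_smul_one_sub_smul_of_isHermitian (G.isHermitian_transMatrix hreg), hcardD, mul_pow,
    pow_mul, mul_assoc]

end SimpleGraph

/-- A function continuous on `[a, b]` agrees there with a bounded continuous function. -/
theorem ContinuousOn.exists_boundedContinuousFunction_eqOn_Icc {a b : ℝ} (hab : a ≤ b) {g : ℝ → ℝ}
    (hg : ContinuousOn g (Set.Icc a b)) :
    ∃ f : BoundedContinuousFunction ℝ ℝ, Set.EqOn f g (Set.Icc a b) := by
  let f₀ : BoundedContinuousFunction (Set.Icc a b) ℝ :=
    BoundedContinuousFunction.mkOfCompact ⟨_, hg.domRestrict⟩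
  refine ⟨f₀.compContinuous ⟨Set.projIcc a b hab, continuous_projIcc⟩, fun t ht => ?_⟩
  simp [f₀, Set.projIcc_of_mem hab ht]

/-- **Grover(Positive Support)/Ihara Zeta Correspondence** (Chinta–Jorgenson–Karlsson).
If `(G_k)` is a sequence of finite simple connected vertex-transitive `(q+1)`-regular
graphs (`q ≥ 2`) with `ν_k = |V(G_k)| → ∞` whose empirical spectral measures of `P(G_k)`
converge weakly to a probability measure `μ_P` on `[-1,1]`, then for suitable real `u`,
`det(I - u U⁺(G_k))^(1/ν_k) → (1 - u²)^((q-1)/2) · exp(∫ log((1 + qu²) - (q+1)uλ) dμ_P(λ))`. -/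
theorem positive_support_ihara_zeta_limit (q : ℕ) (hq : 2 ≤ q) (V : ℕ → Type)
    [∀ k, Fintype (V k)] [∀ k, DecidableEq (V k)] (G : ∀ k, SimpleGraph (V k))
    [∀ k, DecidableRel (G k).Adj]
    (hconn : ∀ k, (G k).Connected)
    (hvt : ∀ k, ∀ v w : V k, ∃ φ : G k ≃g G k, φ v = w)
    (hreg : ∀ k, (G k).IsRegularOfDegree (q + 1))
    (hcard : Tendsto (fun k => Fintype.card (V k)) atTop atTop)
    (μP : Measure ℝ) [IsProbabilityMeasure μP]
    (hsupp : μP (Set.Icc (-1 : ℝ) 1)ᶜ = 0)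
    (hweak : ∀ f : BoundedContinuousFunction ℝ ℝ,
      Tendsto (fun k =>
          (1 / (Fintype.card (V k) : ℝ)) *
            (((transMatrix (G k)).charpoly.roots).map (fun lam => f lam)).sum)
        atTop (nhds (∫ lam, f lam ∂μP)))
    (u : ℝ) (hu : |u| < 1)
    (hpos : ∀ t ∈ Set.Icc (-1 : ℝ) 1, 0 < (1 + (q : ℝ) * u ^ 2) - ((q : ℝ) + 1) * u * t) :
    Tendsto (fun k =>
        (Matrix.det ((1 : Matrix (G k).Dart (G k).Dart ℝ) -
            u • posSupport (groverMatrix (G k)))) ^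
          ((1 : ℝ) / (Fintype.card (V k) : ℝ)))
      atTop
      (nhds ((1 - u ^ 2) ^ (((q : ℝ) - 1) / 2) *
        Real.exp (∫ lam, Real.log ((1 + (q : ℝ) * u ^ 2) - ((q : ℝ) + 1) * u * lam) ∂μP))) := by
  have hw : 0 < 1 - u ^ 2 := sub_pos.mpr ((sq_lt_one_iff_abs_lt_one u).mpr hu)
  set g : ℝ → ℝ := fun t => (1 + (q : ℝ) * u ^ 2) - ((q : ℝ) + 1) * u * t with hg
  have hlog : ContinuousOn (fun t => Real.log (g t)) (Set.Icc (-1) 1) :=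
    ContinuousOn.log (by fun_prop) fun t ht => (hpos t ht).ne'
  obtain ⟨f, hf⟩ := hlog.exists_boundedContinuousFunction_eqOn_Icc (by norm_num)
  have hint : ∫ lam, f lam ∂μP = ∫ lam, Real.log (g lam) ∂μP :=
    integral_congr_ae <| by
      filter_upwards [compl_mem_ae_iff.mpr hsupp] with t ht
      exact hf (not_not.mp ht)
  have hbase : √(1 - u ^ 2) ^ (q + 1) * (1 - u ^ 2)⁻¹ = (1 - u ^ 2) ^ (((q : ℝ) - 1) / 2) := by
    rw [Real.sqrt_eq_rpow, ← Real.rpow_natCast, ← Real.rpow_mul hw.le, ← Real.rpow_neg_one,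
      ← Real.rpow_add hw]
    congr 1
    push_cast
    ring
  rw [← hint]
  refine ((Real.continuous_exp.tendsto _).comp (hweak f)).const_mul _ |>.congr' ?_
  filter_upwards [hcard.eventually_ne_atTop 0] with k hk
  have hroots := fun lam => (G k).mem_Icc_of_mem_roots_charpoly_transMatrix (lam := lam)
  have hprod : ((transMatrix (G k)).charpoly.roots.map g).prod =
      Real.exp ((transMatrix (G k)).charpoly.roots.map fun lam => f lam).sum := by
    rw [Real.exp_multiset_sum, Multiset.map_map]
    congr 1
    refine Multiset.map_congr rfl fun lam hlam => ?_
    rw [Function.comp_apply, hf (hroots lam hlam), Real.exp_log (hpos lam (hroots lam hlam))]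
  rw [(G k).det_one_sub_smul_posSupport_groverMatrix hq (hreg k) hu, hprod, hbase,
    Real.mul_rpow (by positivity) (Real.exp_pos _).le, ← Real.exp_mul, one_div,
    Real.pow_rpow_inv_natCast (by positivity) hk, Function.comp_apply, one_div, mul_comm _⁻¹]
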